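/- arXiv:2305.08519 — 2 statements merged into one kernel-verified Lean document; each statement's English description precedes it below -/
import Mathlib

section
/- Let G be a graph on vertex set {1,...,n} and let S ⊆ {1,...,n} be non-empty and not an independent set (i.e., at least two vertices of S are adjacent). Then S is a clique of G if and only if every partition of S is highly regular for G. -/
open Matrix BigOperators

/-- `e_G(S₁,S₂)`: the number of ordered pairs of adjacent vertices in `S₁ × S₂`. -/
noncomputable def eG {n : ℕ} (A : Matrix (Fin n) (Fin n) ℝ) (S₁ S₂ : Finset (Fin n)) : ℕ :=
  ((S₁ ×ˢ S₂).filter (fun p => A p.1 p.2 = 1)).card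

/-- The edge density `d_G(S₁,S₂) = e_G(S₁,S₂)/(|S₁||S₂|)`. -/
noncomputable def dG {n : ℕ} (A : Matrix (Fin n) (Fin n) ℝ) (S₁ S₂ : Finset (Fin n)) : ℝ :=
  (eG A S₁ S₂ : ℝ) / ((S₁.card : ℝ) * (S₂.card : ℝ))

theorem eG_eq_sum {n : ℕ} (A : Matrix (Fin n) (Fin n) ℝ) (S T : Finset (Fin n)) :
    eG A S T = ∑ i ∈ S, (T.filter (fun j => A i j = 1)).card := by
  simp only [eG, Finset.card_filter, Finset.sum_product]

theorem eG_singleton_left {n : ℕ} (A : Matrix (Fin n) (Fin n) ℝ) (i : Fin n)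
    (T : Finset (Fin n)) : eG A {i} T = (T.filter (fun j => A i j = 1)).card := by
  rw [eG_eq_sum, Finset.sum_singleton]

theorem dG_eq_dG_singleton_of_const {n : ℕ} (A : Matrix (Fin n) (Fin n) ℝ)
    {S T : Finset (Fin n)} {i : Fin n} (hi : i ∈ S)
    (h : ∀ j ∈ S, eG A {j} T = eG A {i} T) : dG A S T = dG A {i} T := by
  have hsum : eG A S T = S.card * eG A {i} T := by
    rw [eG_eq_sum, ← smul_eq_mul, ← Finset.sum_const]
    exact Finset.sum_congr rfl fun j hj => by rw [← eG_singleton_left, h j hj]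
  have hS : (S.card : ℝ) ≠ 0 := Nat.cast_ne_zero.mpr (Finset.card_ne_zero_of_mem hi)
  simp only [dG, hsum, Finset.card_singleton, Nat.cast_mul, Nat.cast_one, one_mul]
  exact mul_div_mul_left _ _ hS

theorem dG_singleton_singleton {n : ℕ} (A : Matrix (Fin n) (Fin n) ℝ) (i j : Fin n) :
    dG A {i} {j} = if A i j = 1 then 1 else 0 := by
  simp only [dG, eG_singleton_left, Finset.filter_singleton]
  split_ifs <;> simp

/-- In a clique, the number of neighbours in `T` of a vertex outside `T` is `|T|`, and that of a
vertex of `T` is `|T| - 1`. -/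
theorem eG_singleton_of_clique {n : ℕ} {A : Matrix (Fin n) (Fin n) ℝ} (hdiag : ∀ i, A i i = 0)
    {S T : Finset (Fin n)} (hT : T ⊆ S) (hclique : ∀ i ∈ S, ∀ j ∈ S, i ≠ j → A i j = 1)
    {i : Fin n} (hi : i ∈ S) : eG A {i} T = (T.erase i).card := by
  rw [eG_singleton_left]
  congr 1
  ext j
  rw [Finset.mem_filter, Finset.mem_erase, and_comm]
  refine and_congr_left fun hj => ⟨?_, fun hne => hclique i hi j (hT hj) hne.symm⟩
  rintro h rfl
  simp [hdiag] at h

/-- A non-empty, non-independent set `S` of vertices is a clique iff every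
partition of `S` is highly regular for `G`. -/
theorem clique_iff_every_partition_highly_regular
    (n : ℕ) (A : Matrix (Fin n) (Fin n) ℝ)
    (hsymm : A.IsSymm)
    (h01 : ∀ i j, A i j = 0 ∨ A i j = 1)
    (hdiag : ∀ i, A i i = 0)
    (S : Finset (Fin n)) (hS : S.Nonempty)
    (hnotind : ∃ i ∈ S, ∃ j ∈ S, A i j = 1) :
    (∀ i ∈ S, ∀ j ∈ S, i ≠ j → A i j = 1) ↔
      (∀ (k : ℕ) (V : Fin k → Finset (Fin n)),
        (∀ ℓ, (V ℓ).Nonempty) →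
        (∀ ℓ m, ℓ ≠ m → Disjoint (V ℓ) (V m)) →
        Finset.univ.biUnion V = S →
        ∀ ℓ m, ∀ i ∈ V ℓ, dG A (V ℓ) (V m) = dG A {i} (V m)) := by
  constructor
  · intro hclique k V _ hdisj hunion ℓ m i hi
    have hsub : ∀ ℓ, V ℓ ⊆ S := fun ℓ =>
      hunion ▸ Finset.subset_biUnion_of_mem V (Finset.mem_univ ℓ)
    refine dG_eq_dG_singleton_of_const A hi fun j hj => ?_
    rw [eG_singleton_of_clique hdiag (hsub m) hclique (hsub ℓ hj),
      eG_singleton_of_clique hdiag (hsub m) hclique (hsub ℓ hi)]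
    by_cases hlm : ℓ = m
    · subst hlm
      rw [Finset.card_erase_of_mem hj, Finset.card_erase_of_mem hi]
    · have hd := hdisj ℓ m hlm
      rw [Finset.erase_eq_of_notMem (Finset.disjoint_left.mp hd hj),
        Finset.erase_eq_of_notMem (Finset.disjoint_left.mp hd hi)]
  · intro hreg
    -- The partition `{S \ {c}, {c}}` shows that `c` is adjacent to all or none of `S \ {c}`.
    have hcol : ∀ c ∈ S, ∀ i ∈ S, ∀ j ∈ S, i ≠ c → j ≠ c → A i c = 1 → A j c = 1 := by
      intro c hc i hi j hj hic hjc hA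
      have hp := hreg 2 ![S.erase c, {c}]
        (by
          simp only [Fin.forall_fin_two, Matrix.cons_val_zero, Matrix.cons_val_one]
          exact ⟨⟨i, Finset.mem_erase.mpr ⟨hic, hi⟩⟩, Finset.singleton_nonempty c⟩)
        (by simp [Fin.forall_fin_two])
        (by
          ext x
          simp only [Finset.mem_biUnion, Finset.mem_univ, true_and, Fin.exists_fin_two,
            Matrix.cons_val_zero, Matrix.cons_val_one, Finset.mem_erase, Finset.mem_singleton]
          grind) 0 1
      simp only [Matrix.cons_val_zero, Matrix.cons_val_one] at hp
      have hij := (hp i (Finset.mem_erase.mpr ⟨hic, hi⟩)).symm.trans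
        (hp j (Finset.mem_erase.mpr ⟨hjc, hj⟩))
      rw [dG_singleton_singleton, dG_singleton_singleton, if_pos hA] at hij
      by_contra hne
      simp [hne] at hij
    obtain ⟨a, ha, b, hb, hab⟩ := hnotind
    have hne : a ≠ b := by
      rintro rfl
      simp [hdiag] at hab
    have hb_all : ∀ i ∈ S, i ≠ b → A i b = 1 := fun i hi hib =>
      hcol b hb a ha i hi hne hib hab
    intro i hi j hj hij
    by_cases hjb : j = b
    · subst hjb
      exact hb_all i hi hij
    · refine hcol j hj b hb i hi (Ne.symm hjb) hij ?_
      rw [← hsymm.apply]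
      exact hb_all j hj hjb
end

section
/- Let G be a graph on vertex set {1,...,n} with adjacency matrix A, let c ∈ ℝ, let x ∈ Δₙ, let 𝒫 = {V₁,...,V_k} be a partition of supp(x) that separates distinct values of x, let D be the density matrix with entries d_{ℓm} = d_G(V_ℓ, V_m), let Λ = diag(|V₁|,...,|V_k|), and let y ∈ Δ_k be the barycentric coordinates of x with respect to 𝒫. If 𝒫 is highly regular for G, then x ∈ gKKT_c(G) if and only if there exists λ ∈ ℝ with ((D + cΛ⁻¹)y)_ℓ = λ for every ℓ ∈ {1,...,k}. -/
open Matrix BigOperators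

/-- The characteristic vector of a non-empty set `S` of vertices: `1/|S|` on `S`, `0` elsewhere. -/
noncomputable def charVec {n : ℕ} (S : Finset (Fin n)) : Fin n → ℝ :=
  fun i => if i ∈ S then ((S.card : ℝ))⁻¹ else 0

/-- The set of generalized KKT points of the parametric Motzkin–Straus program. -/
def gKKT {n : ℕ} (A : Matrix (Fin n) (Fin n) ℝ) (c : ℝ) : Set (Fin n → ℝ) :=
  {x | x ∈ stdSimplex ℝ (Fin n) ∧
    ∃ lam : ℝ, ∀ i, x i ≠ 0 → ((A + c • 1) *ᵥ x) i = lam}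

/-- For a 0-1 matrix, averaging row `i` over `S` gives the density between `{i}` and `S`. -/
lemma mulVec_charVec {n : ℕ} {A : Matrix (Fin n) (Fin n) ℝ}
    (h01 : ∀ i j, A i j = 0 ∨ A i j = 1) (S : Finset (Fin n)) (i : Fin n) :
    (A *ᵥ charVec S) i = dG A {i} S := by
  have hcount : (eG A {i} S : ℝ) = ∑ j ∈ S, A i j := by
    rw [eG, Finset.card_filter, Finset.sum_product, Finset.sum_singleton, Nat.cast_sum]
    refine Finset.sum_congr rfl fun j _ => ?_
    rcases h01 i j with h | h <;> simp [h]
  simp [mulVec, dotProduct, charVec, dG, hcount, Finset.sum_mul, div_eq_mul_inv]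

/-- A combination of characteristic vectors of disjoint sets is constant on each set. -/
lemma sum_mul_charVec_of_mem {n k : ℕ} {V : Fin k → Finset (Fin n)}
    (hdisj : ∀ ℓ m, ℓ ≠ m → Disjoint (V ℓ) (V m)) (y : Fin k → ℝ)
    {ℓ : Fin k} {i : Fin n} (hi : i ∈ V ℓ) :
    ∑ m, y m * charVec (V m) i = y ℓ * ((V ℓ).card : ℝ)⁻¹ := by
  rw [Finset.sum_eq_single ℓ]
  · simp [charVec, hi]
  · intro m _ hm
    simp [charVec, Finset.disjoint_left.mp (hdisj ℓ m hm.symm) hi]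
  · simp

/-- For a highly regular family, the value of `A + cI` at a combination of characteristic
vectors agrees on `V ℓ` with the `ℓ`-th value of the reduced matrix `D + cΛ⁻¹`. -/
lemma mulVec_sum_charVec_eq_of_mem {n k : ℕ} {A : Matrix (Fin n) (Fin n) ℝ} (c : ℝ)
    (h01 : ∀ i j, A i j = 0 ∨ A i j = 1) {V : Fin k → Finset (Fin n)}
    (hdisj : ∀ ℓ m, ℓ ≠ m → Disjoint (V ℓ) (V m))
    (hhr : ∀ ℓ m, ∀ i ∈ V ℓ, dG A (V ℓ) (V m) = dG A {i} (V m))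
    (y : Fin k → ℝ) {ℓ : Fin k} {i : Fin n} (hi : i ∈ V ℓ) :
    ((A + c • 1) *ᵥ fun j => ∑ m, y m * charVec (V m) j) i =
      (((Matrix.of fun ℓ' m => dG A (V ℓ') (V m)) +
        c • Matrix.diagonal (fun ℓ' => (((V ℓ').card : ℝ))⁻¹)) *ᵥ y) ℓ := by
  have hA : (A *ᵥ fun j => ∑ m, y m * charVec (V m) j) i =
      ((Matrix.of fun ℓ' m => dG A (V ℓ') (V m)) *ᵥ y) ℓ := by
    simp only [mulVec, dotProduct, Finset.mul_sum, of_apply]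
    rw [Finset.sum_comm]
    refine Finset.sum_congr rfl fun m _ => ?_
    rw [hhr ℓ m i hi, ← mulVec_charVec h01, mulVec, dotProduct, Finset.sum_mul]
    exact Finset.sum_congr rfl fun j _ => by ring
  simp only [add_mulVec, smul_mulVec, one_mulVec, Pi.add_apply, Pi.smul_apply,
    mulVec_diagonal, hA, sum_mul_charVec_of_mem hdisj y hi, smul_eq_mul, mul_comm (y ℓ)]

/-- If the partition `𝒫 = {V₁,…,V_k}` of `supp(x)` separating distinct
values of `x` is highly regular for `G`, then `x` is a generalized KKT point iff its
barycentric coordinates `y` form a KKT point of the reduced program with matrix `D + cΛ⁻¹`. -/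
theorem gkkt_iff_barycentric_kkt_of_highly_regular
    (n : ℕ) (A : Matrix (Fin n) (Fin n) ℝ) (c : ℝ)
    (hsymm : A.IsSymm)
    (h01 : ∀ i j, A i j = 0 ∨ A i j = 1)
    (hdiag : ∀ i, A i i = 0)
    (x : Fin n → ℝ) (hx : x ∈ stdSimplex ℝ (Fin n))
    (k : ℕ) (V : Fin k → Finset (Fin n))
    (hne : ∀ ℓ, (V ℓ).Nonempty)
    (hdisj : ∀ ℓ m, ℓ ≠ m → Disjoint (V ℓ) (V m))
    (hcover : Finset.univ.biUnion V = Finset.univ.filter (fun i => x i ≠ 0))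
    (hsep : ∀ ℓ, ∀ i ∈ V ℓ, ∀ j ∈ V ℓ, x i = x j)
    (hhr : ∀ ℓ m, ∀ i ∈ V ℓ, dG A (V ℓ) (V m) = dG A {i} (V m))
    (y : Fin k → ℝ) (hy : y ∈ stdSimplex ℝ (Fin k))
    (hxy : x = fun i => ∑ ℓ, y ℓ * charVec (V ℓ) i) :
    x ∈ gKKT A c ↔
      ∃ lam : ℝ, ∀ ℓ,
        (((Matrix.of fun ℓ' m => dG A (V ℓ') (V m)) +
            c • Matrix.diagonal (fun ℓ' => (((V ℓ').card : ℝ))⁻¹)) *ᵥ y) ℓ = lam := by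
  have hkey : ∀ ℓ, ∀ i ∈ V ℓ, ((A + c • 1) *ᵥ x) i =
      (((Matrix.of fun ℓ' m => dG A (V ℓ') (V m)) +
        c • Matrix.diagonal (fun ℓ' => (((V ℓ').card : ℝ))⁻¹)) *ᵥ y) ℓ := by
    intro ℓ i hi
    rw [hxy]
    exact mulVec_sum_charVec_eq_of_mem c h01 hdisj hhr y hi
  have hsupp : ∀ i, x i ≠ 0 ↔ ∃ ℓ, i ∈ V ℓ := fun i => by
    simpa using (Finset.ext_iff.mp hcover i).symm
  constructor
  · rintro ⟨-, lam, hlam⟩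
    refine ⟨lam, fun ℓ => ?_⟩
    obtain ⟨i, hi⟩ := hne ℓ
    rw [← hkey ℓ i hi]
    exact hlam i ((hsupp i).mpr ⟨ℓ, hi⟩)
  · rintro ⟨lam, hlam⟩
    refine ⟨hx, lam, fun i hi => ?_⟩
    obtain ⟨ℓ, hℓ⟩ := (hsupp i).mp hi
    rw [hkey ℓ i hℓ]
    exact hlam ℓ
end
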